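/- Let T be a triangulated category with arbitrary small coproducts, P a compact generator of T, and X, Y objects of T such that proj dim π_*X ≤ 1 in the category of graded right Λ-modules. Then X and Y are isomorphic in T if and only if π_*X and π_*Y are isomorphic as graded right Λ-modules. -/

import Mathlib

/-!
Shared setup: a triangulated category `C` with (co)products, a compact generator `P`,
the graded endomorphism ring `Λ = End_T(P)_* = Hom_T(Σ^* P, P)` and its category of
graded right modules, realized concretely.
-/

set_option linter.unusedSectionVars false

open CategoryTheory CategoryTheory.Limits CategoryTheory.Pretriangulated DirectSum

universe v u

namespace Franke

variable {C : Type u} [Category.{v} C] [Preadditive C] [HasZeroObject C]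
  [HasShift C ℤ] [∀ n : ℤ, (shiftFunctor C n).Additive] [Pretriangulated C]

/-- The degree `k` component of the graded endomorphism ring
`Λ = End_T(P)_* = Hom_T(Σ^* P, P)`: its degree `k` part is `Hom(P⟦k⟧, P)`. -/
abbrev lam (P : C) (k : ℤ) : Type v := (P⟦k⟧ ⟶ P)

/-- The right action of a degree `k` element `a : Σᵏ P ⟶ P` of `Λ` on a degree `n`
element `m : Σⁿ P ⟶ X` of the graded hom `π_* X = Hom_T(Σ^* P, X)`; the result is the
degree `n + k` element `Σ^{n+k} P ≅ (Σᵏ P)⟦n⟧ → Σⁿ P → X`. -/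
def gsmulHom (P : C) {X : C} {n k l : ℤ} (h : n + k = l)
    (m : P⟦n⟧ ⟶ X) (a : lam P k) : P⟦l⟧ ⟶ X :=
  (shiftFunctorAdd' C k n l (by omega)).hom.app P ≫ a⟦n⟧' ≫ m

/-- The multiplication of the graded endomorphism ring `Λ = End_T(P)_*`. -/
def gmul (P : C) {j k l : ℤ} (h : j + k = l) (a : lam P j) (b : lam P k) : lam P l :=
  gsmulHom P h a b

/-- The unit `1 ∈ Λ₀ = Hom(Σ⁰P, P)` of the graded endomorphism ring. -/
def gone (P : C) : lam P 0 := (shiftFunctorZero C ℤ).hom.app P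

/-- A ℤ-graded right module over the graded endomorphism ring `Λ = End_T(P)_*`.
The action is indexed by proofs `n + k = l` in order to avoid transport along
equalities of degrees. -/
structure GradedModule (P : C) where
  M : ℤ → Type v
  [acg : ∀ n, AddCommGroup (M n)]
  smul : ∀ {n k l : ℤ}, n + k = l → M n → lam P k → M l
  smul_addₓ : ∀ {n k l : ℤ} (h : n + k = l) (m : M n) (a b : lam P k),
    smul h m (a + b) = smul h m a + smul h m b
  add_smulₓ : ∀ {n k l : ℤ} (h : n + k = l) (m m' : M n) (a : lam P k),
    smul h (m + m') a = smul h m a + smul h m' a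
  smul_oneₓ : ∀ {n : ℤ} (m : M n), smul (add_zero n) m (gone P) = m
  smul_mulₓ : ∀ {n j k nj jk njk : ℤ} (h₁ : n + j = nj) (h₂ : j + k = jk)
    (h₃ : nj + k = njk) (h₄ : n + jk = njk) (m : M n) (a : lam P j) (b : lam P k),
    smul h₃ (smul h₁ m a) b = smul h₄ m (gmul P h₂ a b)

attribute [instance] GradedModule.acg

/-- The action of a fixed `a : Λₖ` as an additive map `Mₙ →+ M_{n+k}`. -/
def GradedModule.smulAddHom {P : C} (M : GradedModule P) {n k l : ℤ} (h : n + k = l)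
    (a : lam P k) : M.M n →+ M.M l :=
  AddMonoidHom.mk' (fun m => M.smul h m a) (fun m m' => M.add_smulₓ h m m' a)

theorem GradedModule.zero_smulₓ {P : C} (M : GradedModule P) {n k l : ℤ} (h : n + k = l)
    (a : lam P k) : M.smul h (0 : M.M n) a = 0 :=
  map_zero (M.smulAddHom h a)

/-- `π_* X = Hom_T(Σ^* P, X)` as a graded right `Λ`-module. -/
@[reducible] def piMod (P X : C) : GradedModule P where
  M n := P⟦n⟧ ⟶ X
  smul h m a := gsmulHom P h m a
  smul_addₓ h m a b := by
    simp [gsmulHom, Functor.map_add, Preadditive.comp_add, Preadditive.add_comp]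
  add_smulₓ h m m' a := by
    simp [gsmulHom, Preadditive.comp_add]
  smul_oneₓ m := by
    simp only [gsmulHom, gone]
    rw [shiftFunctorAdd'_zero_add_hom_app, ← Functor.map_comp_assoc, Iso.inv_hom_id_app]
    simp
  smul_mulₓ {n j k nj jk njk} h₁ h₂ h₃ h₄ m a b := by
    simp only [gsmulHom, gmul, Functor.map_comp, Category.assoc]
    have nat := ((shiftFunctorAdd' C j n nj (by omega)).hom).naturality b
    dsimp at nat
    rw [reassoc_of% nat]
    rw [← shiftFunctorAdd'_assoc_hom_app_assoc k j n jk nj njk (by omega) (by omega)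
      (by omega) P]


/-- A morphism of graded right `Λ`-modules: a degree-preserving `Λ`-linear additive map. -/
structure GHom {P : C} (M N : GradedModule P) where
  app : ∀ n : ℤ, M.M n →+ N.M n
  app_smul : ∀ {n k l : ℤ} (h : n + k = l) (m : M.M n) (a : lam P k),
    app l (M.smul h m a) = N.smul h (app n m) a

@[ext] theorem GHom.ext {P : C} {M N : GradedModule P} {f g : GHom M N}
    (h : ∀ (n : ℤ) (x : M.M n), f.app n x = g.app n x) : f = g := by
  obtain ⟨fa, _⟩ := f; obtain ⟨ga, _⟩ := g
  congr 1
  funext n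
  exact AddMonoidHom.ext (h n)

/-- The identity morphism of graded modules. -/
def GHom.id {P : C} (M : GradedModule P) : GHom M M :=
  ⟨fun _ => AddMonoidHom.id _, fun _ _ _ => rfl⟩

/-- Composition of morphisms of graded modules. -/
def GHom.comp {P : C} {M N K : GradedModule P} (g : GHom N K) (f : GHom M N) : GHom M K :=
  ⟨fun n => (g.app n).comp (f.app n), fun h m a => by
    simp only [AddMonoidHom.comp_apply, f.app_smul, g.app_smul]⟩

instance {P : C} {M N : GradedModule P} : Zero (GHom M N) :=
  ⟨{ app := fun _ => 0
     app_smul := fun h m a => by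
       show (0 : N.M _) = N.smul h (0 : N.M _) a
       exact (N.zero_smulₓ h a).symm }⟩

@[simp] theorem GHom.zero_app {P : C} {M N : GradedModule P} (n : ℤ) (x : M.M n) :
    (0 : GHom M N).app n x = 0 := rfl

/-- An isomorphism of graded right `Λ`-modules. -/
structure GIso {P : C} (M N : GradedModule P) where
  hom : GHom M N
  inv : GHom N M
  hom_inv_id : inv.comp hom = GHom.id M
  inv_hom_id : hom.comp inv = GHom.id N

/-- The shift `M[k]` of a graded module, with `M[k]ₙ = M_{n-k}`. -/
@[reducible] def gshift {P : C} (k : ℤ) (M : GradedModule P) : GradedModule P where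
  M n := M.M (n - k)
  smul h m a := M.smul (by omega) m a
  smul_addₓ h m a b := M.smul_addₓ _ m a b
  add_smulₓ h m m' a := M.add_smulₓ _ m m' a
  smul_oneₓ m := M.smul_oneₓ m
  smul_mulₓ h₁ h₂ h₃ h₄ m a b := M.smul_mulₓ _ h₂ _ _ m a b

/-- Surjectivity (in each degree) of a morphism of graded modules. -/
def GHom.Surj {P : C} {M N : GradedModule P} (f : GHom M N) : Prop :=
  ∀ n : ℤ, Function.Surjective (f.app n)

/-- A pair of composable morphisms of graded modules `0 → Z → E → B → 0`
forming a short exact sequence. -/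
structure IsShortExact {P : C} {Z E B : GradedModule P} (ι : GHom Z E) (ρ : GHom E B) : Prop where
  mono : ∀ n : ℤ, Function.Injective (ι.app n)
  epi : ∀ n : ℤ, Function.Surjective (ρ.app n)
  exact : ∀ (n : ℤ) (x : E.M n), ρ.app n x = 0 ↔ x ∈ Set.range (ι.app n)

/-- Exactness of `M → N → K` at `N` (including that the composite vanishes). -/
def ExactPair {P : C} {M N K : GradedModule P} (f : GHom M N) (g : GHom N K) : Prop :=
  ∀ (n : ℤ) (x : N.M n), g.app n x = 0 ↔ x ∈ Set.range (f.app n)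

/-- A graded module is projective if every degreewise surjection onto it splits against
any map from it: the usual lifting property. -/
def IsProjective {P : C} (Q : GradedModule P) : Prop :=
  ∀ (A B : GradedModule P) (e : GHom A B), e.Surj →
    ∀ f : GHom Q B, ∃ g : GHom Q A, e.comp g = f

/-- `projDimLE d M` says that the graded module `M` admits a projective resolution of
length at most `d`, i.e. has projective dimension `≤ d`. -/
def projDimLE {P : C} : ℕ → GradedModule P → Prop
  | 0, M => IsProjective M
  | d + 1, M => ∃ (F K : GradedModule P) (ε : GHom F M) (ι : GHom K F),
      IsProjective F ∧ IsShortExact ι ε ∧ projDimLE d K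

/-- `Λ = End_T(P)_*` is `N`-sparse: concentrated in degrees divisible by `N`. -/
def Sparse (P : C) (N : ℕ) : Prop :=
  ∀ k : ℤ, ¬ ((N : ℤ) ∣ k) → ∀ a : lam P k, a = 0

/-- A graded module belongs to `B[i]`: it is concentrated in degrees congruent
to `i` modulo `N`. -/
def InDegrees {P : C} (N : ℕ) (i : ZMod N) (M : GradedModule P) : Prop :=
  ∀ n : ℤ, (n : ZMod N) ≠ i → ∀ x : M.M n, x = 0

/-- The canonical comparison map `⊕ᵢ Hom(P, Xᵢ) → Hom(P, ∐ᵢ Xᵢ)`. -/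
noncomputable def compactComparison [HasCoproducts.{v} C] (P : C) {ι : Type v} (X : ι → C) :
    (⨁ i, (P ⟶ X i)) →+ (P ⟶ ∐ X) := by
  classical
  exact DirectSum.toAddMonoid fun i =>
    AddMonoidHom.mk' (fun f => f ≫ Sigma.ι X i) (fun f g => Preadditive.add_comp _ _ _ _ _ _)

/-- `P` is a compact object: `Hom(P, −)` commutes with small coproducts. -/
def IsCompactObj [HasCoproducts.{v} C] (P : C) : Prop :=
  ∀ (ι : Type v) (X : ι → C), Function.Bijective (compactComparison P X)

/-- `P` is a generator: an object all of whose graded homs from `P` vanish is zero. -/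
def IsGenerator (P : C) : Prop :=
  ∀ X : C, (∀ (n : ℤ) (f : P⟦n⟧ ⟶ X), f = 0) → IsZero X

/-- The morphism of graded modules `π_* f : π_* X → π_* Y` induced by `f : X ⟶ Y`. -/
def piGHom (P : C) {X Y : C} (f : X ⟶ Y) : GHom (piMod P X) (piMod P Y) where
  app n := AddMonoidHom.mk' (fun u => u ≫ f) fun u v => Preadditive.add_comp _ _ _ _ _ _
  app_smul h m a := by
    show (gsmulHom P h m a) ≫ f = gsmulHom P h (m ≫ f) a
    simp [gsmulHom]

/-- An extension of `B` by `Z` in the category of graded right `Λ`-modules: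
  a short exact sequence `0 → Z → E → B → 0`. -/
structure GExtension {P : C} (B Z : GradedModule P) where
  E : GradedModule P
  ι : GHom Z E
  ρ : GHom E B
  shortExact : IsShortExact ι ρ

/-- Two extensions are identified if there is a morphism of extensions between them
(such a morphism is automatically an isomorphism). -/
def GExtension.Rel {P : C} {B Z : GradedModule P} (e e' : GExtension B Z) : Prop :=
  ∃ φ : GHom e.E e'.E, φ.comp e.ι = e'.ι ∧ e'.ρ.comp φ = e.ρ

/-- `Ext¹_Λ(B, Z)`, realized as the set of equivalence classes of extensions
`0 → Z → E → B → 0` of graded right `Λ`-modules. -/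
def Ext1 {P : C} (B Z : GradedModule P) : Type _ :=
  Quot (GExtension.Rel (B := B) (Z := Z))

/-- Given `δ : Cc ⟶ ΣX`, the induced morphism of graded modules
`π_* Cc → (π_* X)[1]`, using the canonical identification `π_*(ΣX) ≅ (π_*X)[1]`. -/
noncomputable def triangleConnect (P : C) {X Cc : C} (δ : Cc ⟶ X⟦(1:ℤ)⟧) :
    GHom (piMod P Cc) (gshift 1 (piMod P X)) where
  app n := AddMonoidHom.mk' (fun u =>
    (shiftFunctorAdd' C n (-1) (n-1) (by omega)).hom.app P ≫ (u ≫ δ)⟦(-1:ℤ)⟧' ≫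
      (shiftFunctorCompIsoId C (1:ℤ) (-1) (by omega)).hom.app X) (fun u v => by
        simp [Preadditive.add_comp, Preadditive.comp_add, Functor.map_add])
  app_smul {n k l} h m a := by
    simp only [AddMonoidHom.mk'_apply]
    show (shiftFunctorAdd' C l (-1) (l-1) (by omega)).hom.app P ≫
        ((gsmulHom P h m a) ≫ δ)⟦(-1:ℤ)⟧' ≫
          (shiftFunctorCompIsoId C (1:ℤ) (-1) (by omega)).hom.app X =
      gsmulHom P (show (n-1) + k = l - 1 by omega)
        ((shiftFunctorAdd' C n (-1) (n-1) (by omega)).hom.app P ≫ (m ≫ δ)⟦(-1:ℤ)⟧' ≫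
          (shiftFunctorCompIsoId C (1:ℤ) (-1) (by omega)).hom.app X) a
    simp only [gsmulHom, Functor.map_comp, Category.assoc]
    have nat := ((shiftFunctorAdd' C n (-1) (n-1) (by omega : n + -1 = n - 1)).hom).naturality a
    dsimp at nat
    rw [reassoc_of% nat]
    rw [shiftFunctorAdd'_assoc_hom_app_assoc k n (-1) l (n-1) (l-1) (by omega) (by omega)
      (by omega) P]

section ExtGroups

instance {P : C} {M N : GradedModule P} : Add (GHom M N) :=
  ⟨fun f g =>
    { app := fun n => f.app n + g.app n
      app_smul := fun {n k l} h m a => by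
        show f.app l _ + g.app l _ = N.smul h (f.app n m + g.app n m) a
        rw [f.app_smul, g.app_smul, N.add_smulₓ] }⟩

instance {P : C} {M N : GradedModule P} : Neg (GHom M N) :=
  ⟨fun f =>
    { app := fun n => -(f.app n)
      app_smul := fun {n k l} h m a => by
        show -(f.app l _) = N.smul h (-(f.app n m)) a
        rw [f.app_smul]
        exact (map_neg (N.smulAddHom h a) _).symm }⟩

@[simp] theorem GHom.add_app {P : C} {M N : GradedModule P} (f g : GHom M N) (n : ℤ)
    (x : M.M n) : (f + g).app n x = f.app n x + g.app n x := rfl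

@[simp] theorem GHom.neg_app {P : C} {M N : GradedModule P} (f : GHom M N) (n : ℤ)
    (x : M.M n) : (-f).app n x = -(f.app n x) := rfl

instance {P : C} {M N : GradedModule P} : AddCommGroup (GHom M N) where
  add := (· + ·)
  zero := 0
  neg := Neg.neg
  add_assoc f g h := by ext n x; simp [add_assoc]
  zero_add f := by ext n x; simp
  add_zero f := by ext n x; simp
  add_comm f g := by ext n x; simp [add_comm]
  neg_add_cancel f := by ext n x; simp
  nsmul := nsmulRec
  zsmul := zsmulRec

/-- A projective resolution `⋯ → F₂ → F₁ → F₀ → B → 0` of a graded right `Λ`-module. -/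
structure ProjResolution {P : C} (B : GradedModule P) where
  F : ℕ → GradedModule P
  d : ∀ i : ℕ, GHom (F (i + 1)) (F i)
  aug : GHom (F 0) B
  projective : ∀ i, IsProjective (F i)
  aug_surjective : ∀ n : ℤ, Function.Surjective (aug.app n)
  exact_aug : ∀ (n : ℤ) (x : (F 0).M n), aug.app n x = 0 ↔ x ∈ Set.range ((d 0).app n)
  exact_d : ∀ (i : ℕ) (n : ℤ) (x : (F (i + 1)).M n),
    (d i).app n x = 0 ↔ x ∈ Set.range ((d (i + 1)).app n)

/-- The differential of the cochain complex `Hom_Λ(F_•, Z)` obtained by applying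
`Hom_Λ(−, Z)` to a projective resolution `F_•`. -/
def cochainD {P : C} {B : GradedModule P} (R : ProjResolution B) (Z : GradedModule P)
    (i : ℕ) : GHom (R.F i) Z →+ GHom (R.F (i + 1)) Z :=
  AddMonoidHom.mk' (fun f => f.comp (R.d i)) (fun f g => by ext n x; rfl)

/-- `Ext^{j+1}_Λ(B, Z)`, computed as the `(j+1)`-st cohomology
`ker(Hom(F_{j+1}, Z) → Hom(F_{j+2}, Z)) / im(Hom(F_j, Z) → Hom(F_{j+1}, Z))`
of the complex `Hom_Λ(F_•, Z)` for a projective resolution `F_• → B`. -/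
def extGroup {P : C} {B : GradedModule P} (R : ProjResolution B) (Z : GradedModule P)
    (j : ℕ) : Type v :=
  AddMonoidHom.ker (cochainD R Z (j + 1)) ⧸
    (AddMonoidHom.range (cochainD R Z j)).addSubgroupOf
      (AddMonoidHom.ker (cochainD R Z (j + 1)))

noncomputable instance {P : C} {B : GradedModule P} (R : ProjResolution B)
    (Z : GradedModule P) (j : ℕ) : AddCommGroup (extGroup R Z j) := by
  dsimp [extGroup]; infer_instance

end ExtGroups
section DG

/-- A differential graded right module over `Λ = End_T(P)_*`, where `Λ` is regarded as a
DG ring with zero differential: a graded right `Λ`-module together with a square-zero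
`Λ`-linear differential of degree `-1`. -/
structure DGMod (P : C) where
  gm : GradedModule P
  d : ∀ {n m : ℤ}, m + 1 = n → (gm.M n →+ gm.M m)
  d_sq : ∀ {n m j : ℤ} (h : m + 1 = n) (h' : j + 1 = m) (x : gm.M n), d h' (d h x) = 0
  d_smul : ∀ {n m j l l' : ℤ} (h : m + 1 = n) (hl : n + j = l) (hl' : l' + 1 = l)
    (hm : m + j = l') (x : gm.M n) (a : lam P j),
    d hl' (gm.smul hl x a) = gm.smul hm (d h x) a

/-- A morphism of DG `Λ`-modules: a morphism of the underlying graded modules commuting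
with the differentials. -/
structure DGHom {P : C} (M N : DGMod P) where
  g : GHom M.gm N.gm
  comm : ∀ {n m : ℤ} (h : m + 1 = n) (x : M.gm.M n),
    g.app m (M.d h x) = N.d h (g.app n x)

@[ext] theorem DGHom.ext {P : C} {M N : DGMod P} {f f' : DGHom M N}
    (h : ∀ (n : ℤ) (x : M.gm.M n), f.g.app n x = f'.g.app n x) : f = f' := by
  obtain ⟨fg, _⟩ := f; obtain ⟨fg', _⟩ := f'
  congr 1
  exact GHom.ext h

/-- The category of differential graded right `Λ`-modules. -/
instance dgModCategory (P : C) : Category (DGMod P) where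
  Hom M N := DGHom M N
  id M := ⟨GHom.id _, fun _ _ => rfl⟩
  comp f g := ⟨g.g.comp f.g, fun h x => by
    show g.g.app _ (f.g.app _ _) = _
    rw [f.comm, g.comm]
    rfl⟩
  id_comp f := by apply DGHom.ext; intros; rfl
  comp_id f := by apply DGHom.ext; intros; rfl
  assoc f g h := by apply DGHom.ext; intros; rfl

/-- The cycles `ker dₙ` of a DG module in degree `n`. -/
abbrev cycles {P : C} (M : DGMod P) (n : ℤ) : AddSubgroup (M.gm.M n) :=
  AddMonoidHom.ker (M.d (n := n) (m := n - 1) (by omega))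

/-- The boundaries `im d_{n+1}` of a DG module in degree `n`. -/
abbrev boundaries {P : C} (M : DGMod P) (n : ℤ) : AddSubgroup (M.gm.M n) :=
  AddMonoidHom.range (M.d (n := n + 1) (m := n) rfl)

/-- The homology `H_n M = ker dₙ / im d_{n+1}` of a DG module. -/
abbrev dgHomology {P : C} (M : DGMod P) (n : ℤ) : Type v :=
  cycles M n ⧸ (boundaries M n).addSubgroupOf (cycles M n)

/-- The map induced on cycles by a morphism of DG modules. -/
def cyclesMap {P : C} {M N : DGMod P} (f : M ⟶ N) (n : ℤ) : cycles M n →+ cycles N n :=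
  AddMonoidHom.codRestrict ((f.g.app n).comp (cycles M n).subtype) _ (fun x => by
    have hx : M.d (show (n - 1) + 1 = n by omega) x.1 = 0 := x.2
    have : N.d (show (n - 1) + 1 = n by omega) (f.g.app n x.1) = 0 := by
      rw [← f.comm (show (n - 1) + 1 = n by omega), hx, map_zero]
    exact this)

/-- The map induced on homology by a morphism of DG modules. -/
def dgHomologyMap {P : C} {M N : DGMod P} (f : M ⟶ N) (n : ℤ) :
    dgHomology M n →+ dgHomology N n :=
  QuotientAddGroup.map _ _ (cyclesMap f n) (by
    intro x hx
    have hx' : x.1 ∈ boundaries M n := hx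
    obtain ⟨y, hy⟩ := AddMonoidHom.mem_range.mp hx'
    have : (f.g.app n x.1) ∈ boundaries N n := by
      refine AddMonoidHom.mem_range.mpr ⟨f.g.app (n + 1) y, ?_⟩
      rw [← f.comm rfl y, hy]
    exact this)

/-- A quasi-isomorphism of DG modules: a morphism inducing an isomorphism on homology. -/
def quasiIso (P : C) : MorphismProperty (DGMod P) :=
  fun _ _ f => ∀ n : ℤ, Function.Bijective (dgHomologyMap f n)

/-- The derived category `D(Λ)` of the graded endomorphism ring `Λ = End_T(P)_*`
(regarded as a DG ring with zero differential): the localization of the category of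
DG right `Λ`-modules at the quasi-isomorphisms. -/
abbrev DerivedCat (P : C) := (quasiIso P).Localization

end DG


section FreeModules

open scoped Classical in
theorem compactComparison_of [HasCoproducts.{v} C] (P : C) {ι : Type v} (X : ι → C) (i : ι)
    (f : P ⟶ X i) :
    compactComparison P X (DirectSum.of (fun i => P ⟶ X i) i f) = f ≫ Sigma.ι X i := by
  simp only [compactComparison]
  rw [DirectSum.toAddMonoid_of]
  rfl

theorem IsCompactObj.shift [HasCoproducts.{v} C] {P : C} (hP : IsCompactObj P) (n : ℤ) :
    IsCompactObj (P⟦n⟧) := by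
  classical
  intro ι X
  let adj := (shiftEquiv C n).toAdjunction
  have : (shiftEquiv C n).functor.Additive := inferInstanceAs (shiftFunctor C n).Additive
  let G := (shiftEquiv C n).inverse
  let e (Z : C) : (P⟦n⟧ ⟶ Z) ≃+ (P ⟶ G.obj Z) := adj.homAddEquiv P Z
  let c : (P ⟶ ∐ fun i => G.obj (X i)) ≃ (P ⟶ G.obj (∐ X)) :=
    (PreservesCoproduct.iso G X).symm.homToEquiv
  have key : ⇑(compactComparison (P⟦n⟧) X) =
      (e (∐ X)).symm ∘ c ∘ compactComparison P (fun i => G.obj (X i)) ∘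
        DirectSum.map (fun i => (e (X i)).toAddMonoidHom) := by
    funext x
    induction x using DirectSum.induction_on with
    | zero => simp [c]
    | of i f =>
      simp only [Function.comp, DirectSum.map_of, compactComparison_of]
      refine ((e (∐ X)).symm_apply_eq.2 ?_).symm
      simp only [c, Iso.homToEquiv_apply, Iso.symm_hom, PreservesCoproduct.inv_hom, Category.assoc,
        ι_comp_sigmaComparison]
      exact (adj.homEquiv_naturality_right f (Sigma.ι X i)).symm
    | add x y hx hy =>
      simp only [Function.comp, map_add] at hx hy ⊢
      rw [hx, hy, ← map_add]
      simp [c]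
  rw [key]
  refine (e _).symm.bijective.comp (c.bijective.comp ((hP _ _).comp ⟨?_, ?_⟩))
  · exact DirectSum.map_injective _ |>.2 fun i => (e (X i)).injective
  · exact DirectSum.map_surjective _ |>.2 fun i => (e (X i)).surjective

/-- Desuspension identifies `Λ_k` with the maps `Σⁿ P ⟶ Σᵈ P`, where `d + k = n`. -/
noncomputable def lamShift (P : C) {d k n : ℤ} (h : d + k = n) : lam P k ≃+ (P⟦n⟧ ⟶ P⟦d⟧) :=
  AddEquiv.ofBijective (AddMonoidHom.mk' (fun b => gsmulHom P h (𝟙 (P⟦d⟧)) b) fun a b => by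
      simp [gsmulHom]) <| by
    have : Function.Bijective fun b : lam P k =>
        (shiftFunctorAdd' C k d n (by omega)).hom.app P ≫ b⟦d⟧' :=
      (((shiftFunctorAdd' C k d n (by omega)).app P).symm.homFromEquiv.bijective).comp
        ⟨(shiftFunctor C d).map_injective, (shiftFunctor C d).map_surjective⟩
    simpa [gsmulHom, Function.comp_def] using this

theorem lamShift_comp (P : C) {d k n : ℤ} (h : d + k = n) (b : lam P k) {X : C}
    (m : P⟦d⟧ ⟶ X) : lamShift P h b ≫ m = gsmulHom P h m b := by
  simp [lamShift, gsmulHom]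

variable [HasCoproducts.{v} C]

/-- The coproduct of the shifts `Σ^{d j} P`, whose homotopy is a free `Λ`-module. -/
noncomputable abbrev freeObj (P : C) {J : Type v} (d : J → ℤ) : C := ∐ fun j => P⟦d j⟧

/-- The tautological generator of `π_*` of `freeObj P d` in degree `d j`. -/
noncomputable abbrev freeGen (P : C) {J : Type v} (d : J → ℤ) (j : J) : P⟦d j⟧ ⟶ freeObj P d :=
  Sigma.ι (fun j => P⟦d j⟧) j

/-- The elements of `π_n` of `freeObj P d` are the finite combinations of the generators. -/
noncomputable def freeCoeff {P : C} (hP : IsCompactObj P) {J : Type v} (d : J → ℤ) (n : ℤ) :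
    (⨁ j, lam P (n - d j)) ≃+ (P⟦n⟧ ⟶ freeObj P d) :=
  (DFinsupp.mapRange.addEquiv fun j => lamShift P (show d j + (n - d j) = n by omega)).trans
    (AddEquiv.ofBijective (compactComparison (P⟦n⟧) fun j => P⟦d j⟧) (hP.shift n _ _))

open scoped Classical in
theorem freeCoeff_of {P : C} (hP : IsCompactObj P) {J : Type v} (d : J → ℤ) (n : ℤ) (j : J)
    (b : lam P (n - d j)) :
    freeCoeff hP d n (DirectSum.of (fun j => lam P (n - d j)) j b) =
      gsmulHom P (show d j + (n - d j) = n by omega) (freeGen P d j) b := by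
  have : freeCoeff hP d n (DirectSum.of (fun j => lam P (n - d j)) j b) =
    compactComparison (P⟦n⟧) (fun j => P⟦d j⟧) (DirectSum.map
      (fun j => (lamShift P (show d j + (n - d j) = n by omega)).toAddMonoidHom)
      (DirectSum.of (fun j => lam P (n - d j)) j b)) := rfl
  rw [this, DirectSum.map_of, compactComparison_of]
  exact lamShift_comp P _ b _

theorem free_induction {P : C} (hP : IsCompactObj P) {J : Type v} (d : J → ℤ)
    {motive : ∀ n, (P⟦n⟧ ⟶ freeObj P d) → Prop}
    (zero : ∀ n, motive n 0)
    (add : ∀ n x y, motive n x → motive n y → motive n (x + y))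
    (gen : ∀ (n k : ℤ) (j : J) (h : d j + k = n) (b : lam P k),
      motive n (gsmulHom P h (freeGen P d j) b))
    (n : ℤ) (x : P⟦n⟧ ⟶ freeObj P d) : motive n x := by
  classical
  obtain ⟨y, rfl⟩ := (freeCoeff hP d n).surjective x
  induction y using DirectSum.induction_on with
  | zero => simpa using zero n
  | of j b => rw [freeCoeff_of]; exact gen _ _ _ _ _
  | add x y hx hy => rw [map_add]; exact add _ _ _ hx hy

theorem GHom.ext_of_free {P : C} (hP : IsCompactObj P) {J : Type v} {d : J → ℤ}
    {A : GradedModule P} {f g : GHom (piMod P (freeObj P d)) A}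
    (h : ∀ j, f.app (d j) (freeGen P d j) = g.app (d j) (freeGen P d j)) : f = g := by
  ext n x
  induction n, x using free_induction hP d with
  | zero n => exact (map_zero (f.app n)).trans (map_zero (g.app n)).symm
  | add n x y hx hy =>
    exact (map_add (f.app n) x y).trans ((congrArg₂ _ hx hy).trans (map_add (g.app n) x y).symm)
  | gen n k j hk b =>
    exact (f.app_smul hk _ b).trans ((congrArg (A.smul hk · b) (h j)).trans
      (g.app_smul hk _ b).symm)

/-- `π_*` of `freeObj P d` is free: a graded map out of it may be prescribed on generators. -/
theorem exists_freeLift {P : C} (hP : IsCompactObj P) {J : Type v} (d : J → ℤ)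
    (A : GradedModule P) (a : ∀ j, A.M (d j)) :
    ∃ g : GHom (piMod P (freeObj P d)) A, ∀ j, g.app (d j) (freeGen P d j) = a j := by
  classical
  let φ (n : ℤ) : (P⟦n⟧ ⟶ freeObj P d) →+ A.M n :=
    (DirectSum.toAddMonoid fun j => AddMonoidHom.mk'
      (fun b : lam P (n - d j) => A.smul (show d j + (n - d j) = n by omega) (a j) b)
      (A.smul_addₓ _ _)).comp (freeCoeff hP d n).symm.toAddMonoidHom
  have hφ {n k : ℤ} (j : J) (h : d j + k = n) (b : lam P k) :
      φ n (gsmulHom P h (freeGen P d j) b) = A.smul h (a j) b := by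
    obtain rfl : k = n - d j := by omega
    have : (freeCoeff hP d n).symm (gsmulHom P h (freeGen P d j) b) =
        DirectSum.of (fun j => lam P (n - d j)) j b :=
      (AddEquiv.symm_apply_eq _).2 (freeCoeff_of hP d n j b).symm
    change DirectSum.toAddMonoid _ ((freeCoeff hP d n).symm _) = _
    rw [this, DirectSum.toAddMonoid_of]
    rfl
  refine ⟨⟨φ, fun {n k l} h m c => ?_⟩, fun j => ?_⟩
  · change φ l (gsmulHom P h m c) = A.smul h (φ n m) c
    induction n, m using free_induction hP d with
    | zero n =>
      rw [map_zero, A.zero_smulₓ]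
      convert map_zero (φ l)
      simp [gsmulHom]
    | add n x y hx hy =>
      rw [map_add, A.add_smulₓ, ← hx, ← hy, ← map_add]
      congr 1
      simp [gsmulHom]
    | gen n k' j hk b =>
      rw [hφ, A.smul_mulₓ hk rfl h (show d j + (k' + k) = l by omega), ← hφ]
      congr 1
      exact (piMod P (freeObj P d)).smul_mulₓ hk rfl h (by omega) (freeGen P d j) b c
  · have h1 : freeGen P d j = gsmulHom P (add_zero (d j)) (freeGen P d j) (gone P) :=
      ((piMod P (freeObj P d)).smul_oneₓ (n := d j) (freeGen P d j)).symm
    change φ (d j) (freeGen P d j) = a j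
    rw [h1, hφ, A.smul_oneₓ]

theorem isProjective_free {P : C} (hP : IsCompactObj P) {J : Type v} (d : J → ℤ) :
    IsProjective (piMod P (freeObj P d)) := by
  intro A B e he f
  choose a ha using fun j => he (d j) (f.app (d j) (freeGen P d j))
  obtain ⟨g, hg⟩ := exists_freeLift hP d A a
  refine ⟨g, GHom.ext_of_free hP fun j => ?_⟩
  change e.app _ (g.app _ _) = _
  rw [hg, ha]

/-- `π_*` is full on maps out of `freeObj P d`. -/
theorem exists_piGHom_eq {P : C} (hP : IsCompactObj P) {J : Type v} {d : J → ℤ} {Y : C}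
    (φ : GHom (piMod P (freeObj P d)) (piMod P Y)) :
    ∃ g : freeObj P d ⟶ Y, piGHom P g = φ := by
  refine ⟨Sigma.desc fun j => φ.app (d j) (freeGen P d j), GHom.ext_of_free hP fun j => ?_⟩
  change freeGen P d j ≫ _ = _
  simp [freeGen]

theorem free_hom_ext {P : C} {J : Type v} {d : J → ℤ} {Y : C} {f g : freeObj P d ⟶ Y}
    (h : piGHom P f = piGHom P g) : f = g :=
  Sigma.hom_ext _ _ fun j => congrArg (fun φ : GHom _ _ => φ.app (d j) (freeGen P d j)) h

/-- Every object receives a map from some `freeObj P d` that is surjective on `π_*`. -/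
theorem exists_free_cover (P X : C) :
    ∃ (J : Type v) (d : J → ℤ) (p : freeObj P d ⟶ X), (piGHom P p).Surj := by
  refine ⟨Σ n : ℤ, (P⟦n⟧ ⟶ X), Sigma.fst, Sigma.desc fun j => j.2, fun n x => ?_⟩
  exact ⟨freeGen P (Sigma.fst : (Σ n : ℤ, (P⟦n⟧ ⟶ X)) → ℤ) ⟨n, x⟩, Sigma.ι_desc _ _⟩

end FreeModules

section Idempotents

/-- Idempotents split in a triangulated category with small coproducts. -/
theorem exists_splitting_of_idempotent [HasCoproducts.{v} C] {V : C} (e : V ⟶ V)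
    (he : e ≫ e = e) : ∃ (K : C) (i : K ⟶ V) (r : V ⟶ K), i ≫ r = 𝟙 K ∧ r ≫ i = e := by
  let S : ULift.{v} ℕ → C := fun _ => V
  let ι (n : ℕ) : V ⟶ ∐ S := Sigma.ι S ⟨n⟩
  have hι {Z : C} {f g : ∐ S ⟶ Z} (h : ∀ n, ι n ≫ f = ι n ≫ g) : f = g :=
    Sigma.hom_ext _ _ fun n => h n.down
  -- An Eilenberg swindle makes the complement of `e` on the zeroth summand split.
  let σ : ∐ S ⟶ ∐ S := Sigma.desc fun n =>
    Nat.casesOn n.down ((𝟙 V - e) ≫ ι 0) fun m => (𝟙 V - e) ≫ ι (m + 1) + e ≫ ι m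
  let τ : ∐ S ⟶ ∐ S := Sigma.desc fun n => (𝟙 V - e) ≫ ι n.down + e ≫ ι (n.down + 1)
  let π : ∐ S ⟶ V := Sigma.desc fun n => Nat.casesOn n.down (𝟙 V) fun _ => 0
  have hσ0 : ι 0 ≫ σ = (𝟙 V - e) ≫ ι 0 := Sigma.ι_desc _ _
  have hσ (n : ℕ) : ι (n + 1) ≫ σ = (𝟙 V - e) ≫ ι (n + 1) + e ≫ ι n := Sigma.ι_desc _ _
  have hτ (n : ℕ) : ι n ≫ τ = (𝟙 V - e) ≫ ι n + e ≫ ι (n + 1) := Sigma.ι_desc _ _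
  have hπ0 : ι 0 ≫ π = 𝟙 V := Sigma.ι_desc _ _
  have hπ (n : ℕ) : ι (n + 1) ≫ π = 0 := Sigma.ι_desc _ _
  have he' {Z : C} (f : V ⟶ Z) : e ≫ e ≫ f = e ≫ f := by rw [← Category.assoc, he]
  have hτσ : τ ≫ σ = 𝟙 _ := by
    refine hι fun n => ?_
    rw [← Category.assoc, hτ]
    cases n <;> simp [Preadditive.sub_comp, Preadditive.comp_sub, hσ0, hσ, he']
  have hστ : 𝟙 _ - σ ≫ τ = π ≫ e ≫ ι 0 := by
    refine hι fun n => ?_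
    rw [Preadditive.comp_sub, ← Category.assoc, ← Category.assoc]
    cases n <;> simp [Preadditive.add_comp, Preadditive.sub_comp, Preadditive.comp_add,
      Preadditive.comp_sub, hσ0, hσ, hτ, hπ0, hπ, he']
  have : IsSplitEpi σ := ⟨⟨⟨τ, hτσ⟩⟩⟩
  obtain ⟨K, k, δ, hT⟩ := distinguished_cocone_triangle₁ σ
  have hkσ : k ≫ σ = 0 := comp_distTriang_mor_zero₁₂ _ hT
  have : Mono k := Triangle.mono₁ _ hT <|
    Triangle.mor₃_eq_zero_of_epi₂ _ hT (inferInstanceAs (Epi σ))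
  obtain ⟨r, hr⟩ : ∃ r : V ⟶ K, e ≫ ι 0 = r ≫ k := Triangle.coyoneda_exact₂ _ hT (e ≫ ι 0) (by
    change (e ≫ ι 0) ≫ σ = 0
    simp [hσ0, Preadditive.comp_sub, Preadditive.sub_comp, he'])
  refine ⟨K, k ≫ π, r, ?_, ?_⟩
  · rw [← cancel_mono k, Category.assoc, Category.assoc, ← hr, ← hστ, Preadditive.comp_sub,
      reassoc_of% hkσ]
    simp
  · rw [← reassoc_of% hr, hπ0, Category.comp_id]

end Idempotents

section Kernels

theorem IsShortExact.lift {P : C} {Z E B D : GradedModule P} {ι : GHom Z E} {ρ : GHom E B}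
    (h : IsShortExact ι ρ) (φ : GHom D E) (hφ : ρ.comp φ = 0) :
    ∃ ψ : GHom D Z, ι.comp ψ = φ := by
  have hx (n : ℤ) (x : D.M n) : ρ.app n (φ.app n x) = 0 :=
    congrArg (fun f : GHom D B => f.app n x) hφ
  choose ψ hψ using fun n x => (h.exact n _).1 (hx n x)
  refine ⟨⟨fun n => AddMonoidHom.mk' (ψ n) fun x y => h.mono n ?_, fun {n k l} hl m a =>
    h.mono l ?_⟩, GHom.ext hψ⟩
  · simp only [map_add, hψ]
  · change ι.app l (ψ l _) = ι.app l (Z.smul hl (ψ n m) a)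
    rw [ι.app_smul, hψ, hψ, φ.app_smul]

/-- Schanuel's lemma: if one syzygy of `M` is projective, then so is every other one. -/
theorem IsProjective.of_isShortExact {P : C} {K F K' G M : GradedModule P}
    {ι : GHom K F} {ε : GHom F M} {ι' : GHom K' G} {ρ : GHom G M}
    (h : IsShortExact ι ε) (h' : IsShortExact ι' ρ)
    (hK : IsProjective K) (hF : IsProjective F) (hG : IsProjective G) : IsProjective K' := by
  obtain ⟨α, hα⟩ := hF G M ρ h'.epi ε
  obtain ⟨β, hβ⟩ := hG F M ε h.epi ρ
  have hα' n x : ρ.app n (α.app n x) = ε.app n x := congrArg (fun f : GHom F M => f.app n x) hα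
  have hβ' n x : ε.app n (β.app n x) = ρ.app n x := congrArg (fun f : GHom G M => f.app n x) hβ
  obtain ⟨t, ht⟩ := h'.lift (GHom.id G + -(α.comp β)) (by
    ext n x
    change ρ.app n (x + -(α.app n (β.app n x))) = 0
    rw [map_add, map_neg, hα', hβ', add_neg_cancel])
  obtain ⟨a, ha⟩ := h'.lift (α.comp ι) (by
    ext n x
    exact (hα' n _).trans ((h.exact n _).2 ⟨x, rfl⟩))
  obtain ⟨b, hb⟩ := h.lift (β.comp ι') (by
    ext n x
    exact (hβ' n _).trans ((h'.exact n _).2 ⟨x, rfl⟩))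
  have ht' n x : ι'.app n (t.app n x) = x + -(α.app n (β.app n x)) :=
    congrArg (fun f : GHom G G => f.app n x) ht
  have ha' n x : ι'.app n (a.app n x) = α.app n (ι.app n x) :=
    congrArg (fun f : GHom K G => f.app n x) ha
  have hb' n x : ι.app n (b.app n x) = β.app n (ι'.app n x) :=
    congrArg (fun f : GHom K' F => f.app n x) hb
  intro A B e he f
  obtain ⟨g₁, hg₁⟩ := hG A B e he (f.comp t)
  obtain ⟨g₂, hg₂⟩ := hK A B e he (f.comp a)
  have hg₁' n x : e.app n (g₁.app n x) = f.app n (t.app n x) :=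
    congrArg (fun f : GHom G B => f.app n x) hg₁
  have hg₂' n x : e.app n (g₂.app n x) = f.app n (a.app n x) :=
    congrArg (fun f : GHom K B => f.app n x) hg₂
  refine ⟨g₁.comp ι' + g₂.comp b, ?_⟩
  ext n x
  change e.app n (g₁.app n (ι'.app n x) + g₂.app n (b.app n x)) = f.app n x
  rw [map_add, hg₁', hg₂', ← map_add]
  congr 1
  apply h'.mono n
  rw [map_add, ht', ha', hb', neg_add_cancel_right]

end Kernels

section Realization

@[simp] theorem piGHom_app (P : C) {X Y : C} (f : X ⟶ Y) (n : ℤ) (x : P⟦n⟧ ⟶ X) :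
    (piGHom P f).app n x = x ≫ f := rfl

theorem piGHom_comp (P : C) {X Y Z : C} (f : X ⟶ Y) (g : Y ⟶ Z) :
    piGHom P (f ≫ g) = (piGHom P g).comp (piGHom P f) :=
  GHom.ext fun _ x => (Category.assoc x f g).symm

theorem piGHom_id (P X : C) : piGHom P (𝟙 X) = GHom.id _ :=
  GHom.ext fun _ x => Category.comp_id x

/-- Every map `ΣⁿP ⟶ ΣX` is, up to an isomorphism of its source, a suspension. -/
theorem exists_iso_comp_eq_shift (P : C) {n : ℤ} {X : C} (x : P⟦n⟧ ⟶ X⟦(1 : ℤ)⟧) :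
    ∃ (y : P⟦n - 1⟧ ⟶ X) (i : P⟦n⟧ ≅ (P⟦n - 1⟧)⟦(1 : ℤ)⟧), x = i.hom ≫ y⟦(1 : ℤ)⟧' := by
  let i := (shiftFunctorAdd' C (n - 1) 1 n (by omega)).app P
  obtain ⟨y, hy⟩ := (shiftFunctor C (1 : ℤ)).map_surjective (i.inv ≫ x)
  exact ⟨y, i, by rw [hy, Iso.hom_inv_id_assoc]⟩

/-- A map inducing isomorphisms on `π_*` is an isomorphism. -/
theorem isIso_of_piGHom_bijective {P : C} (hgen : IsGenerator P) {X Y : C} (f : X ⟶ Y)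
    (hf : ∀ n, Function.Bijective ((piGHom P f).app n)) : IsIso f := by
  obtain ⟨Z, g, δ, hT⟩ := distinguished_cocone_triangle f
  refine (Triangle.isZero₃_iff_isIso₁ _ hT).1 (hgen Z fun n x => ?_)
  obtain ⟨y, i, hy⟩ := exists_iso_comp_eq_shift P (x ≫ δ)
  have hy0 : y = 0 := by
    refine (hf (n - 1)).1 ?_
    rw [map_zero, piGHom_app]
    apply (shiftFunctor C (1 : ℤ)).map_injective
    rw [← cancel_epi i.hom, Functor.map_comp, ← reassoc_of% hy]
    have hδf : δ ≫ f⟦(1 : ℤ)⟧' = 0 := comp_distTriang_mor_zero₃₁ _ hT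
    simp [hδf]
  obtain ⟨z, hz⟩ : ∃ z : P⟦n⟧ ⟶ Y, x = z ≫ g := Triangle.coyoneda_exact₃ _ hT x (by
    change x ≫ δ = 0
    rw [hy, hy0, Functor.map_zero, comp_zero])
  obtain ⟨w, rfl⟩ := (hf n).2 z
  have hfg : f ≫ g = 0 := comp_distTriang_mor_zero₁₂ _ hT
  rw [hz, piGHom_app, Category.assoc, hfg, comp_zero]

theorem isShortExact_of_distTriang {P W' W X : C} {f : W' ⟶ W} {p : W ⟶ X}
    {δ : X ⟶ W'⟦(1 : ℤ)⟧} (hT : Triangle.mk f p δ ∈ distTriang C) (hp : (piGHom P p).Surj) :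
    IsShortExact (piGHom P f) (piGHom P p) := by
  have hfp : f ≫ p = 0 := comp_distTriang_mor_zero₁₂ _ hT
  have hpδ : p ≫ δ = 0 := comp_distTriang_mor_zero₂₃ _ hT
  refine ⟨fun n => (injective_iff_map_eq_zero _).2 fun (x : P⟦n⟧ ⟶ W') hx => ?_, hp,
    fun n x => ⟨fun hx => ?_, ?_⟩⟩
  · change x ≫ f = 0 at hx
    let i := (shiftFunctorAdd' C n 1 (n + 1) rfl).app P
    obtain ⟨g, hg⟩ : ∃ g : (P⟦n⟧)⟦(1 : ℤ)⟧ ⟶ X, x⟦(1 : ℤ)⟧' = g ≫ δ :=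
      Triangle.coyoneda_exact₁ _ hT (x⟦(1 : ℤ)⟧') (by
        change x⟦(1 : ℤ)⟧' ≫ f⟦(1 : ℤ)⟧' = 0
        rw [← Functor.map_comp, hx, Functor.map_zero])
    obtain ⟨w, hw⟩ := hp (n + 1) (i.hom ≫ g)
    rw [piGHom_app] at hw
    apply (shiftFunctor C (1 : ℤ)).map_injective
    rw [Functor.map_zero, ← cancel_epi i.hom]
    rw [hg, ← Category.assoc, ← hw, Category.assoc, hpδ, comp_zero, comp_zero]
  · obtain ⟨g, hg⟩ := Triangle.coyoneda_exact₂ _ hT x hx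
    exact ⟨g, hg.symm⟩
  · rintro ⟨y, rfl⟩
    rw [piGHom_app, piGHom_app, Category.assoc, hfp, comp_zero]

variable [HasCoproducts.{v} C]

/-- `π_*` is faithful on maps out of an object with projective homotopy. -/
theorem eq_zero_of_isProjective {P : C} (hP : IsCompactObj P) (hgen : IsGenerator P) {W Y : C}
    (hW : IsProjective (piMod P W)) (u : W ⟶ Y) (hu : piGHom P u = 0) : u = 0 := by
  obtain ⟨J, d, q, hq⟩ := exists_free_cover P W
  obtain ⟨s, hs⟩ := hW _ _ (piGHom P q) hq (GHom.id _)
  have hs' n (w : P⟦n⟧ ⟶ W) : s.app n w ≫ q = w :=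
    congrArg (fun f : GHom (piMod P W) (piMod P W) => f.app n w) hs
  obtain ⟨e, he⟩ := exists_piGHom_eq hP (s.comp (piGHom P q))
  have he' n (x : P⟦n⟧ ⟶ freeObj P d) : x ≫ e = s.app n (x ≫ q) :=
    congrArg (fun f : GHom (piMod P (freeObj P d)) (piMod P (freeObj P d)) => f.app n x) he
  have hee : e ≫ e = e := free_hom_ext (GHom.ext fun n x => by
    change x ≫ e ≫ e = x ≫ e
    rw [← Category.assoc, he', he', hs'])
  obtain ⟨K, i, r, hir, hri⟩ := exists_splitting_of_idempotent e hee
  have hie : i ≫ e = i := by rw [← hri, reassoc_of% hir]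
  have : IsIso (i ≫ q) := isIso_of_piGHom_bijective hgen _ fun n => by
    refine ⟨(injective_iff_map_eq_zero _).2 fun x hx => ?_, fun w => ⟨s.app n w ≫ r, ?_⟩⟩
    · rw [piGHom_app, ← Category.assoc] at hx
      have h0 : x ≫ i = 0 := by
        rw [← hie, ← Category.assoc, he', hx]
        exact map_zero (s.app n)
      rw [← Category.comp_id x, ← hir, reassoc_of% h0, zero_comp]
    · rw [piGHom_app, Category.assoc, reassoc_of% hri, ← Category.assoc, he', hs', hs']
  have hqu : q ≫ u = 0 := free_hom_ext (by
    rw [piGHom_comp, hu]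
    ext n x
    change _ = x ≫ 0
    rw [comp_zero]
    rfl)
  rw [← cancel_epi (i ≫ q), Category.assoc, hqu, comp_zero, comp_zero]

/-- If `π_* X` has projective dimension at most one, then every map of graded modules out of it
is induced by a morphism. -/
theorem exists_piGHom_eq_of_projDimLE_one {P : C} (hP : IsCompactObj P) (hgen : IsGenerator P)
    {X Y : C} (hX : projDimLE 1 (piMod P X)) (φ : GHom (piMod P X) (piMod P Y)) :
    ∃ h : X ⟶ Y, piGHom P h = φ := by
  obtain ⟨F, K, ε, ι, hF, hι, hK⟩ := hX
  obtain ⟨J, d, p, hp⟩ := exists_free_cover P X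
  obtain ⟨W, f, δ, hT⟩ := distinguished_cocone_triangle₁ p
  have hfp := isShortExact_of_distTriang hT hp
  have hW : IsProjective (piMod P W) := .of_isShortExact hι hfp hK hF (isProjective_free hP d)
  obtain ⟨g, hg⟩ := exists_piGHom_eq hP (φ.comp (piGHom P p))
  have hfg : f ≫ g = 0 := eq_zero_of_isProjective hP hgen hW _ (by
    rw [piGHom_comp, hg]
    ext n x
    change φ.app n ((piGHom P p).app n ((piGHom P f).app n x)) = 0
    rw [(hfp.exact n _).2 ⟨x, rfl⟩]
    exact map_zero (φ.app n))
  obtain ⟨h, hh⟩ : ∃ h : X ⟶ Y, g = p ≫ h := Triangle.yoneda_exact₂ _ hT g hfg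
  refine ⟨h, GHom.ext fun n x => ?_⟩
  obtain ⟨w, rfl⟩ := hp n x
  rw [hh, piGHom_comp] at hg
  exact congrArg (fun f : GHom _ _ => f.app n w) hg

end Realization

/-- Let `P` be a compact generator of the triangulated category `C`
and `X, Y` objects with `proj dim π_* X ≤ 1`. Then `X ≅ Y` in `C` if and only if
`π_* X ≅ π_* Y` as graded right `Λ`-modules. -/
theorem statement_6 [IsTriangulated C] [HasCoproducts.{v} C]
    (P : C) (hcpt : IsCompactObj P) (hgen : IsGenerator P)
    (X Y : C) (hX : projDimLE 1 (piMod P X)) :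
    Nonempty (X ≅ Y) ↔ Nonempty (GIso (piMod P X) (piMod P Y)) := by
  constructor
  · rintro ⟨e⟩
    exact ⟨⟨piGHom P e.hom, piGHom P e.inv,
      by rw [← piGHom_comp, e.hom_inv_id, piGHom_id],
      by rw [← piGHom_comp, e.inv_hom_id, piGHom_id]⟩⟩
  · rintro ⟨e⟩
    obtain ⟨h, hh⟩ := exists_piGHom_eq_of_projDimLE_one hcpt hgen hX e.hom
    have : IsIso h := isIso_of_piGHom_bijective hgen h fun n => by
      rw [hh]
      exact ⟨Function.LeftInverse.injective (g := e.inv.app n) fun x =>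
          congrArg (fun f : GHom _ _ => f.app n x) e.hom_inv_id,
        Function.RightInverse.surjective (g := e.inv.app n) fun x =>
          congrArg (fun f : GHom _ _ => f.app n x) e.inv_hom_id⟩
    exact ⟨asIso h⟩

end Franke
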